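/- arXiv:2410.22190 — 2 statements merged into one kernel-verified Lean document; each statement's English description precedes it below -/
import Mathlib

section
/- (Central Limit Theorem, weak-convergence form.) Let f : Ω → ℝ be Lipschitz and normalized (L_f(1) ≡ 1), let μ_f be a Borel probability on Ω with ∫ L_f(w) dμ_f = ∫ w dμ_f for every bounded continuous w, and let g : Ω → ℝ be Lipschitz. Suppose λ : ℝ → (0, ∞) satisfies λ(0) = 1, that β := log ∘ λ admits a second-order Taylor expansion at 0, β(t) = β′(0)t + ½β″(0)t² + o(t²), with σ² := β″(0) > 0, and that for every z ∈ ℝ one has lim_{n→∞} λ(z/√n)^{-n} ∫_Ω L^n_{f+(z/√n)g}(1) dμ_f = 1. Then for every bounded continuous u : ℝ → ℝ, lim_{n→∞} ∫_Ω u( (1/√n) Σ_{j=0}^{n-1} (g(T^j x) − β′(0)) ) dμ_f(x) = ∫_ℝ u dN(0, σ²); that is, the pushforwards of μ_f under x ↦ (1/√n)(S_n g(x) − n·β′(0)) converge weakly to the centered Gaussian measure of variance σ² on ℝ. -/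
open MeasureTheory Filter Topology

noncomputable section

/-- The left shift on the sequence space `ℕ → M`. -/
def shift {M : Type*} (x : ℕ → M) : ℕ → M := fun n => x (n + 1)

/-- Prepending a symbol `a` to a sequence `x`, so that `shift (cons' a x) = x`. -/
def cons' {M : Type*} (a : M) (x : ℕ → M) : ℕ → M
  | 0 => a
  | n + 1 => x n

/-- The metric `d(x,y) = Σ_n 2⁻ⁿ d_M(x_n, y_n)` on the sequence space `Ω = M^ℕ`. -/
def seqDist {M : Type*} [MetricSpace M] (x y : ℕ → M) : ℝ :=
  ∑' n : ℕ, (1 / 2 : ℝ) ^ n * dist (x n) (y n)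

/-- A function `Ω → ℝ` is Lipschitz for the metric `seqDist`. -/
def LipschitzSeq {M : Type*} [MetricSpace M] (f : (ℕ → M) → ℝ) : Prop :=
  ∃ K : ℝ, 0 ≤ K ∧ ∀ x y, |f x - f y| ≤ K * seqDist x y

/-- The Ruelle operator with a priori measure `ν` and potential `f`. -/
def ruelle {M : Type*} [MeasurableSpace M] (ν : Measure M)
    (f w : (ℕ → M) → ℝ) : (ℕ → M) → ℝ :=
  fun x => ∫ a, Real.exp (f (cons' a x)) * w (cons' a x) ∂ν

open Asymptotics

open BoundedContinuousFunction in
lemma aux_mgf_limit {U : Ultrafilter ℕ} (hU : (U : Filter ℕ) ≤ atTop)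
    (P : ℕ → ProbabilityMeasure ℝ) (Q : ProbabilityMeasure ℝ) (m : ℝ → ℝ)
    (hint : ∀ n z, Integrable (fun x : ℝ => Real.exp (z * x)) (P n : Measure ℝ))
    (hm : ∀ z, Tendsto (fun n => ∫ x, Real.exp (z * x) ∂(P n : Measure ℝ)) atTop (𝓝 (m z)))
    (hQ : Tendsto P U (𝓝 Q)) (z : ℝ) :
    ∫ x, Real.exp (z * x) ∂(Q : Measure ℝ) = m z := by
  obtain ⟨C1, hC1⟩ := (hm z).bddAbove_range
  obtain ⟨C2, hC2⟩ := (hm (2 * z)).bddAbove_range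
  have hC1 : ∀ n, ∫ x, Real.exp (z * x) ∂(P n : Measure ℝ) ≤ C1 := fun n => hC1 ⟨n, rfl⟩
  have hC2 : ∀ n, ∫ x, Real.exp (2 * z * x) ∂(P n : Measure ℝ) ≤ C2 := fun n => hC2 ⟨n, rfl⟩
  let h : ℕ → (ℝ →ᵇ ℝ) := fun k => BoundedContinuousFunction.ofNormedAddCommGroup
    (fun x => min (Real.exp (z * x)) (k : ℝ)) (by fun_prop) k (by
      intro x
      rw [Real.norm_eq_abs, abs_of_nonneg (le_min (Real.exp_pos _).le (Nat.cast_nonneg k))]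
      exact min_le_right _ _)
  have hh : ∀ k x, h k x = min (Real.exp (z * x)) (k : ℝ) := fun k x => rfl
  have hnn : ∀ k x, 0 ≤ h k x := fun k x => le_min (Real.exp_pos _).le (Nat.cast_nonneg k)
  have hle : ∀ k x, h k x ≤ Real.exp (z * x) := fun k x => min_le_left _ _
  have hconv := fun k => (ProbabilityMeasure.tendsto_iff_forall_integral_tendsto.1 hQ) (h k)
  have hQle : ∀ k, ∫ x, h k x ∂(Q : Measure ℝ) ≤ C1 := fun k => by
    refine le_of_tendsto (hconv k) (Eventually.of_forall fun n => ?_)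
    exact (integral_mono ((h k).integrable _) (hint n z) (hle k)).trans (hC1 n)
  have hpt : ∀ x, Tendsto (fun k => h k x) atTop (𝓝 (Real.exp (z * x))) := fun x => by
    refine tendsto_const_nhds.congr' ?_
    filter_upwards [eventually_ge_atTop ⌈Real.exp (z * x)⌉₊] with k hk
    rw [hh, min_eq_left ((Nat.le_ceil _).trans (by exact_mod_cast hk))]
  have hQint : Integrable (fun x => Real.exp (z * x)) (Q : Measure ℝ) := by
    refine ⟨(by fun_prop : Continuous fun x : ℝ => Real.exp (z * x)).aestronglyMeasurable, ?_⟩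
    rw [hasFiniteIntegral_iff_ofReal (Eventually.of_forall fun x => (Real.exp_pos _).le)]
    have : ∫⁻ x, ENNReal.ofReal (Real.exp (z * x)) ∂(Q : Measure ℝ) ≤ ENNReal.ofReal C1 := by
      calc _ = ∫⁻ x, liminf (fun k => ENNReal.ofReal (h k x)) atTop ∂(Q : Measure ℝ) := by
            congr with x
            exact ((ENNReal.continuous_ofReal.tendsto _).comp (hpt x)).liminf_eq.symm
        _ ≤ liminf (fun k => ∫⁻ x, ENNReal.ofReal (h k x) ∂(Q : Measure ℝ)) atTop :=
            lintegral_liminf_le (fun k =>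
              ((h k).continuous.measurable).ennreal_ofReal)
        _ ≤ ENNReal.ofReal C1 := by
            refine liminf_le_of_le (by isBoundedDefault) fun b hb => ?_
            obtain ⟨k, hk⟩ := hb.exists
            refine hk.trans ?_
            rw [← ofReal_integral_eq_lintegral_ofReal ((h k).integrable _)
              (Eventually.of_forall (hnn k))]
            exact ENNReal.ofReal_le_ofReal (hQle k)
    exact this.trans_lt ENNReal.ofReal_lt_top
  have hlim : Tendsto (fun k => ∫ x, h k x ∂(Q : Measure ℝ)) atTop
      (𝓝 (∫ x, Real.exp (z * x) ∂(Q : Measure ℝ))) := by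
    refine tendsto_integral_of_dominated_convergence (fun x => Real.exp (z * x))
      (fun k => (h k).continuous.aestronglyMeasurable) hQint ?_ (Eventually.of_forall hpt)
    intro k
    refine Eventually.of_forall fun x => ?_
    rw [Real.norm_eq_abs, abs_of_nonneg (hnn k x)]
    exact hle k x
  have hbd : ∀ k : ℕ, |∫ x, h (k+1) x ∂(Q : Measure ℝ) - m z| ≤ C2 / ((k + 1 : ℕ) : ℝ) := fun k => by
    refine le_of_tendsto ((hconv (k+1)).sub ((hm z).mono_left hU)).abs
      (Eventually.of_forall fun n => ?_)
    have hk : (0:ℝ) < ((k + 1 : ℕ) : ℝ) := by positivity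
    rw [← integral_sub ((h (k+1)).integrable _) (hint n z)]
    have hi2 : Integrable (fun x : ℝ => Real.exp (2 * z * x) / ((k + 1 : ℕ) : ℝ))
      (P n : Measure ℝ) := (hint n (2 * z)).div_const _
    have h1 : |∫ x, (h (k+1) x - Real.exp (z * x)) ∂(P n : Measure ℝ)| ≤
        ∫ x, Real.exp (2 * z * x) / ((k + 1 : ℕ) : ℝ) ∂(P n : Measure ℝ) := by
      rw [← Real.norm_eq_abs]
      refine norm_integral_le_of_norm_le hi2 (Eventually.of_forall fun x => ?_)
      rw [Real.norm_eq_abs, abs_sub_comm, abs_of_nonneg (sub_nonneg.2 (hle _ x)), hh,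
        le_div_iff₀ hk]
      have he : Real.exp (2 * z * x) = Real.exp (z * x) * Real.exp (z * x) := by
        rw [← Real.exp_add]; ring_nf
      rw [he]
      have hp := Real.exp_pos (z * x)
      rcases le_total (Real.exp (z * x)) ((k + 1 : ℕ) : ℝ) with hc | hc
      · rw [min_eq_left hc]; nlinarith
      · rw [min_eq_right hc]; nlinarith
    refine h1.trans ?_
    rw [integral_div]
    exact div_le_div_of_nonneg_right (hC2 n) hk.le
  have hz : Tendsto (fun k : ℕ => |∫ x, h (k+1) x ∂(Q : Measure ℝ) - m z|) atTop (𝓝 0) := by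
    refine squeeze_zero (fun _ => abs_nonneg _) hbd ?_
    exact (tendsto_const_div_atTop_nhds_zero_nat C2).comp (tendsto_add_atTop_nat 1)
  have h3 := ((hlim.comp (tendsto_add_atTop_nat 1)).sub_const (m z)).abs
  have := tendsto_nhds_unique h3 hz
  linarith [abs_eq_zero.1 this]

lemma aux_tight (P : ℕ → ProbabilityMeasure ℝ) (m : ℝ → ℝ)
    (hint : ∀ n z, Integrable (fun x : ℝ => Real.exp (z * x)) (P n : Measure ℝ))
    (hm : ∀ z, Tendsto (fun n => ∫ x, Real.exp (z * x) ∂(P n : Measure ℝ)) atTop (𝓝 (m z))) :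
    IsTightMeasureSet {((μ : ProbabilityMeasure ℝ) : Measure ℝ) | μ ∈ Set.range P} := by
  obtain ⟨C1, hC1⟩ := (hm 1).bddAbove_range
  obtain ⟨C2, hC2⟩ := (hm (-1)).bddAbove_range
  have hC1 : ∀ n, ∫ x, Real.exp (1 * x) ∂(P n : Measure ℝ) ≤ C1 := fun n => hC1 ⟨n, rfl⟩
  have hC2 : ∀ n, ∫ x, Real.exp (-1 * x) ∂(P n : Measure ℝ) ≤ C2 := fun n => hC2 ⟨n, rfl⟩
  have key : ∀ n (r : ℝ), 0 ≤ r →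
      (P n : Measure ℝ) (Metric.closedBall 0 r)ᶜ ≤ ENNReal.ofReal ((C1 + C2) * Real.exp (-r)) := by
    intro n r hr
    have hi : Integrable (fun x : ℝ => Real.exp (1 * x) + Real.exp (-1 * x)) (P n : Measure ℝ) :=
      (hint n 1).add (hint n (-1))
    have h1 := mul_meas_ge_le_integral_of_nonneg (μ := (P n : Measure ℝ))
      (f := fun x : ℝ => Real.exp (1 * x) + Real.exp (-1 * x))
      (Eventually.of_forall fun x => by positivity) hi (Real.exp r)
    rw [integral_add (hint n 1) (hint n (-1))] at h1
    have h2 : (P n : Measure ℝ).real (Metric.closedBall 0 r)ᶜ ≤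
        (P n : Measure ℝ).real {x : ℝ | Real.exp r ≤ Real.exp (1 * x) + Real.exp (-1 * x)} := by
      refine measureReal_mono ?_
      intro x hx
      simp only [Set.mem_compl_iff, Metric.mem_closedBall, dist_zero_right, not_le,
        Real.norm_eq_abs] at hx
      show Real.exp r ≤ _
      rcases abs_cases x with ⟨h, _⟩ | ⟨h, _⟩
      · have : Real.exp r ≤ Real.exp (1 * x) := Real.exp_le_exp.2 (by linarith)
        linarith [Real.exp_pos (-1 * x)]
      · have : Real.exp r ≤ Real.exp (-1 * x) := Real.exp_le_exp.2 (by linarith)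
        linarith [Real.exp_pos (1 * x)]
    rw [← ofReal_measureReal]
    refine ENNReal.ofReal_le_ofReal (h2.trans ?_)
    rw [Real.exp_neg, ← div_eq_mul_inv, le_div_iff₀ (Real.exp_pos r), mul_comm]
    linarith [hC1 n, hC2 n]
  rw [isTightMeasureSet_iff_exists_isCompact_measure_compl_le]
  intro ε hε
  have hlim : Tendsto (fun r : ℝ => ENNReal.ofReal ((C1 + C2) * Real.exp (-r))) atTop (𝓝 0) := by
    have := (Real.tendsto_exp_neg_atTop_nhds_zero).const_mul (C1 + C2)
    rw [mul_zero] at this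
    simpa [Function.comp_def] using (ENNReal.continuous_ofReal.tendsto _).comp this
  obtain ⟨r, hr, hr0⟩ := ((hlim.eventually (ge_mem_nhds hε)).and (eventually_ge_atTop 0)).exists
  refine ⟨Metric.closedBall 0 r, isCompact_closedBall 0 r, ?_⟩
  rintro _ ⟨_, ⟨n, rfl⟩, rfl⟩
  exact (key n r hr0).trans hr

lemma aux_curtiss (P : ℕ → ProbabilityMeasure ℝ) (v : NNReal) (G : ProbabilityMeasure ℝ)
    (hG : (G : Measure ℝ) = ProbabilityTheory.gaussianReal 0 v)
    (hint : ∀ n z, Integrable (fun x : ℝ => Real.exp (z * x)) (P n : Measure ℝ))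
    (hm : ∀ z, Tendsto (fun n => ∫ x, Real.exp (z * x) ∂(P n : Measure ℝ)) atTop
      (𝓝 (Real.exp (v * z ^ 2 / 2)))) :
    Tendsto P atTop (𝓝 G) := by
  refine (Filter.tendsto_iff_ultrafilter _ _ _).2 fun U hU ↦ ?_
  have h_compact : IsCompact (closure (Set.range P)) :=
    isCompact_closure_of_isTightMeasureSet (aux_tight P _ hint hm)
  obtain ⟨Q, -, hQ : Tendsto _ _ _⟩ := h_compact.ultrafilter_le_nhds (U.map P)
    (.trans (by simp) (monotone_principal subset_closure))
  have hQ' : Tendsto P U (𝓝 Q) := hQ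
  have hmgf : ProbabilityTheory.mgf id (Q : Measure ℝ) =
      ProbabilityTheory.mgf id (ProbabilityTheory.gaussianReal 0 v) := by
    rw [ProbabilityTheory.mgf_id_gaussianReal]
    ext z
    have := aux_mgf_limit hU P Q _ hint hm hQ' z
    simpa [ProbabilityTheory.mgf] using this
  have hset := ProbabilityTheory.integrableExpSet_eq_of_mgf hmgf
  rw [ProbabilityTheory.integrableExpSet_id_gaussianReal] at hset
  have heq := ProbabilityTheory.eqOn_complexMGF_of_mgf hmgf
  have : (Q : Measure ℝ) = G := by
    rw [hG]
    refine Measure.ext_of_complexMGF_id_eq ?_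
    ext z
    exact heq (by simp [hset])
  have : Q = G := Subtype.ext this
  rw [← this]; exact hQ'

lemma aux_cont {M : Type*} [MetricSpace M] [CompactSpace M] {g : (ℕ → M) → ℝ}
    (hg : LipschitzSeq g) : Continuous g := by
  obtain ⟨K, hK, h⟩ := hg
  rw [continuous_iff_continuousAt]
  intro x
  have hc : Continuous fun y : ℕ → M => seqDist y x := by
    unfold seqDist
    refine continuous_tsum (u := fun n => (1 / 2 : ℝ) ^ n * Metric.diam (Set.univ : Set M))
      (fun n => by fun_prop) (summable_geometric_two.mul_right _) fun n y => ?_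
    rw [Real.norm_eq_abs, abs_of_nonneg (by positivity)]
    exact mul_le_mul_of_nonneg_left (Metric.dist_le_diam_of_mem isCompact_univ.isBounded
      (Set.mem_univ _) (Set.mem_univ _)) (by positivity)
  have h0 : seqDist x x = 0 := by simp [seqDist]
  have ht : Tendsto (fun y => K * seqDist y x) (𝓝 x) (𝓝 0) := by
    have := (hc.tendsto x).const_mul K
    rwa [h0, mul_zero] at this
  rw [ContinuousAt, tendsto_iff_dist_tendsto_zero]
  exact squeeze_zero (fun _ => dist_nonneg) (fun y => by rw [Real.dist_eq]; exact h y x) ht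

lemma aux_cont_cons {M : Type*} [TopologicalSpace M] :
    Continuous fun p : (ℕ → M) × M => cons' p.2 p.1 := by
  refine continuous_pi fun n => ?_
  cases n with
  | zero => exact continuous_snd
  | succ n => exact (continuous_apply n).comp continuous_fst

lemma aux_cont_shift {M : Type*} [TopologicalSpace M] :
    Continuous (shift : (ℕ → M) → (ℕ → M)) :=
  continuous_pi fun n => continuous_apply (n + 1)

lemma aux_cont_ruelle {M : Type*} [MetricSpace M] [CompactSpace M]
    [MeasurableSpace M] [BorelSpace M] (ν : Measure M) [IsProbabilityMeasure ν]
    {f w : (ℕ → M) → ℝ} (hf : Continuous f) (hw : Continuous w) :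
    Continuous (ruelle ν f w) := by
  have h : Continuous (Function.uncurry fun (x : ℕ → M) (a : M) =>
      Real.exp (f (cons' a x)) * w (cons' a x)) :=
    (Real.continuous_exp.comp (hf.comp aux_cont_cons)).mul (hw.comp aux_cont_cons)
  have := continuous_parametric_integral_of_continuous (μ := ν) h isCompact_univ
  rw [Measure.restrict_univ] at this
  exact this

lemma aux_iter {M : Type*} [MetricSpace M] [CompactSpace M]
    [MeasurableSpace M] [BorelSpace M] (ν : Measure M) [IsProbabilityMeasure ν]
    {f g : (ℕ → M) → ℝ} (hf : Continuous f) (hg : Continuous g)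
    (μ : Measure (ℕ → M))
    (hfix : ∀ w : (ℕ → M) → ℝ, Continuous w →
      ∫ x, ruelle ν f w x ∂μ = ∫ x, w x ∂μ) (s : ℝ) (n : ℕ) :
    ∀ w : (ℕ → M) → ℝ, Continuous w →
      ∫ x, (ruelle ν (fun y => f y + s * g y))^[n] w x ∂μ =
        ∫ x, Real.exp (s * ∑ j ∈ Finset.range n, g (shift^[j] x)) * w x ∂μ := by
  induction n with
  | zero => intro w _; simp
  | succ n ih =>
    intro w hw
    have hfs : Continuous fun y => f y + s * g y := by fun_prop
    have hS : Continuous fun x : ℕ → M => Real.exp (s * ∑ j ∈ Finset.range n, g (shift^[j] x)) := by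
      refine Real.continuous_exp.comp (continuous_const.mul (continuous_finsetSum _ fun j _ => ?_))
      exact hg.comp (aux_cont_shift.iterate j)
    rw [Function.iterate_succ_apply, ih _ (aux_cont_ruelle ν hfs hw)]
    have hcont : Continuous fun x : ℕ → M =>
        Real.exp (s * ∑ j ∈ Finset.range (n + 1), g (shift^[j] x)) * w x := by
      refine (Real.continuous_exp.comp
        (continuous_const.mul (continuous_finsetSum _ fun j _ => ?_))).mul hw
      exact hg.comp (aux_cont_shift.iterate j)
    rw [← hfix _ hcont]
    congr with x
    simp only [ruelle]
    rw [← integral_const_mul]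
    congr with a
    have hsh : shift (cons' a x) = x := rfl
    rw [Finset.sum_range_succ']
    simp only [Function.iterate_succ_apply, hsh, Function.iterate_zero, id]
    rw [Real.exp_add, mul_add, Real.exp_add]
    ring

lemma aux_taylor (lam : ℝ → ℝ) (β1 σ2 : ℝ)
    (hTaylor : (fun t => Real.log (lam t) - (β1 * t + σ2 / 2 * t ^ 2))
      =o[𝓝 (0 : ℝ)] fun t => t ^ 2) (z : ℝ) :
    Tendsto (fun n : ℕ => n * Real.log (lam (z / Real.sqrt n)) - z * Real.sqrt n * β1) atTop
      (𝓝 (σ2 * z ^ 2 / 2)) := by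
  have ht : Tendsto (fun n : ℕ => z / Real.sqrt (n : ℝ)) atTop (𝓝 0) :=
    Tendsto.div_atTop tendsto_const_nhds
      (Real.tendsto_sqrt_atTop.comp tendsto_natCast_atTop_atTop)
  have h1 := (isBigO_refl (fun n : ℕ => (n : ℝ)) atTop).mul_isLittleO (hTaylor.comp_tendsto ht)
  have h2 : (fun n : ℕ => (n : ℝ) * ((fun t : ℝ => t ^ 2) ∘ fun n : ℕ => z / Real.sqrt (n : ℝ)) n)
      =O[atTop] (fun _ : ℕ => (1 : ℝ)) := by
    refine (isBigO_const_const (z ^ 2) (one_ne_zero : (1:ℝ) ≠ 0) atTop).congr' ?_ EventuallyEq.rfl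
    filter_upwards [eventually_gt_atTop 0] with n hn
    have : (0:ℝ) < n := by exact_mod_cast hn
    simp only [Function.comp]
    rw [div_pow, Real.sq_sqrt this.le]
    field_simp
  have h3 := (isLittleO_one_iff ℝ).1 (h1.trans_isBigO h2)
  have h4 := h3.add_const (σ2 * z ^ 2 / 2)
  rw [zero_add] at h4
  refine h4.congr' ?_
  filter_upwards [eventually_gt_atTop 0] with n hn
  have hn : (0:ℝ) < n := by exact_mod_cast hn
  have hs : 0 < Real.sqrt n := Real.sqrt_pos.2 hn
  have hsq : Real.sqrt n ^ 2 = n := Real.sq_sqrt hn.le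
  simp only [Function.comp]
  have e1 : (n:ℝ) * (z / Real.sqrt n) = z * Real.sqrt n := by
    rw [mul_div_assoc', div_eq_iff hs.ne']; linear_combination (-z) * hsq
  have e2 : (n:ℝ) * (z / Real.sqrt n) ^ 2 = z ^ 2 := by
    rw [div_pow, hsq]; field_simp
  linear_combination (-β1) * e1 - σ2 / 2 * e2

/-- the Central Limit Theorem for Lipschitz-Gibbs probabilities,
weak-convergence form: integrals of bounded continuous test functions of the
normalized Birkhoff sums converge to the corresponding Gaussian integrals. -/
theorem stmt_9 {M : Type*} [MetricSpace M] [CompactSpace M]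
    [MeasurableSpace M] [BorelSpace M]
    (ν : Measure M) [IsProbabilityMeasure ν] [ν.IsOpenPosMeasure]
    (f : (ℕ → M) → ℝ) (hf : LipschitzSeq f)
    (hnorm : ∀ x, ruelle ν f (fun _ => (1 : ℝ)) x = 1)
    (μ : Measure (ℕ → M)) [IsProbabilityMeasure μ]
    (hfix : ∀ w : (ℕ → M) → ℝ, Continuous w →
      ∫ x, ruelle ν f w x ∂μ = ∫ x, w x ∂μ)
    (g : (ℕ → M) → ℝ) (hg : LipschitzSeq g)
    (lam : ℝ → ℝ) (hlampos : ∀ t, 0 < lam t) (hlam0 : lam 0 = 1)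
    (β1 σ2 : ℝ) (hσ2 : 0 < σ2)
    (hTaylor : (fun t => Real.log (lam t) - (β1 * t + σ2 / 2 * t ^ 2))
      =o[𝓝 (0 : ℝ)] fun t => t ^ 2)
    (hspec : ∀ z : ℝ,
      Tendsto
        (fun n : ℕ =>
          ((lam (z / Real.sqrt (n : ℝ))) ^ n)⁻¹ *
            ∫ x, (ruelle ν (fun y => f y + (z / Real.sqrt (n : ℝ)) * g y))^[n]
              (fun _ => (1 : ℝ)) x ∂μ)
        atTop (𝓝 1)) :
    ∀ u : ℝ → ℝ, Continuous u → (∃ C : ℝ, ∀ t, |u t| ≤ C) →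
      Tendsto
        (fun n : ℕ =>
          ∫ x, u ((1 / Real.sqrt (n : ℝ)) *
            ∑ j ∈ Finset.range n, (g (shift^[j] x) - β1)) ∂μ)
        atTop
        (𝓝 (∫ t : ℝ,
          u t * ((Real.sqrt (2 * Real.pi * σ2))⁻¹ * Real.exp (-t ^ 2 / (2 * σ2))))) := by
  have hfc := aux_cont hf
  have hgc := aux_cont hg
  let X : ℕ → (ℕ → M) → ℝ := fun n x =>
    (1 / Real.sqrt (n : ℝ)) * ∑ j ∈ Finset.range n, (g (shift^[j] x) - β1)
  have hX : ∀ n, Continuous (X n) := fun n => by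
    refine continuous_const.mul (continuous_finsetSum _ fun j _ => ?_)
    exact (hgc.comp (aux_cont_shift.iterate j)).sub continuous_const
  have hXm : ∀ n, AEMeasurable (X n) μ := fun n => (hX n).measurable.aemeasurable
  let P : ℕ → ProbabilityMeasure ℝ := fun n =>
    ⟨μ.map (X n), Measure.isProbabilityMeasure_map (hXm n)⟩
  have hP : ∀ n, (P n : Measure ℝ) = μ.map (X n) := fun n => rfl
  have hPint : ∀ n (φ : ℝ → ℝ), Continuous φ →
      ∫ t, φ t ∂(P n : Measure ℝ) = ∫ x, φ (X n x) ∂μ := fun n φ hφ => by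
    rw [hP, integral_map (hXm n) hφ.aestronglyMeasurable]
  have hint : ∀ n z, Integrable (fun x : ℝ => Real.exp (z * x)) (P n : Measure ℝ) := by
    intro n z
    have hφ : Continuous fun x : ℝ => Real.exp (z * x) := by fun_prop
    rw [hP, integrable_map_measure hφ.aestronglyMeasurable (hXm n)]
    have hc := hφ.comp (hX n)
    obtain ⟨C, hC⟩ := (isCompact_univ.image hc).isBounded.exists_norm_le
    exact Integrable.of_bound hc.aestronglyMeasurable C
      (Eventually.of_forall fun x => hC _ ⟨x, Set.mem_univ _, rfl⟩)
  let v : NNReal := ⟨σ2, hσ2.le⟩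
  have hv : v ≠ 0 := fun h => hσ2.ne' (congrArg NNReal.toReal h)
  let G : ProbabilityMeasure ℝ := ⟨ProbabilityTheory.gaussianReal 0 v, inferInstance⟩
  have hm : ∀ z, Tendsto (fun n => ∫ x, Real.exp (z * x) ∂(P n : Measure ℝ)) atTop
      (𝓝 (Real.exp (v * z ^ 2 / 2))) := by
    intro z
    have h1 := (hspec z).mul
      ((Real.continuous_exp.tendsto _).comp (aux_taylor lam β1 σ2 hTaylor z))
    rw [one_mul] at h1
    refine h1.congr' ?_
    filter_upwards [eventually_gt_atTop 0] with n hn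
    have hn : (0:ℝ) < n := by exact_mod_cast hn
    have hs : 0 < Real.sqrt n := Real.sqrt_pos.2 hn
    have hsq : Real.sqrt n ^ 2 = n := Real.sq_sqrt hn.le
    rw [hPint n _ (by fun_prop),
      aux_iter ν hfc hgc μ hfix (z / Real.sqrt n) n _ continuous_const]
    simp only [Function.comp]
    have hl : lam (z / Real.sqrt n) ^ n = Real.exp (n * Real.log (lam (z / Real.sqrt n))) := by
      rw [Real.exp_nat_mul, Real.exp_log (hlampos _)]
    rw [hl, Real.exp_sub, mul_comm, ← mul_assoc, div_mul_eq_mul_div,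
      mul_inv_cancel₀ (Real.exp_pos _).ne', ← integral_const_mul]
    congr with x
    rw [mul_one, one_div, ← Real.exp_neg, ← Real.exp_add]
    congr 1
    simp only [X]
    rw [Finset.sum_sub_distrib, Finset.sum_const, Finset.card_range, nsmul_eq_mul]
    have e : (n : ℝ) / Real.sqrt n = Real.sqrt n := by
      rw [div_eq_iff hs.ne', ← sq, hsq]
    linear_combination z * β1 * e
  have hT := aux_curtiss P v G rfl hint hm
  intro u hu ⟨C, hC⟩
  have h2 := (ProbabilityMeasure.tendsto_iff_forall_integral_tendsto.1 hT)
    (BoundedContinuousFunction.ofNormedAddCommGroup u hu C hC)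
  simp only [BoundedContinuousFunction.coe_ofNormedAddCommGroup] at h2
  have h3 : ∫ t, u t ∂(G : Measure ℝ) = ∫ t : ℝ,
          u t * ((Real.sqrt (2 * Real.pi * σ2))⁻¹ * Real.exp (-t ^ 2 / (2 * σ2))) := by
    show ∫ t, u t ∂(ProbabilityTheory.gaussianReal 0 v) = _
    rw [ProbabilityTheory.integral_gaussianReal_eq_integral_smul hv]
    congr with t
    simp only [ProbabilityTheory.gaussianPDFReal, smul_eq_mul, sub_zero]
    rw [mul_comm]
    rfl
  rw [h3] at h2
  exact h2.congr fun n => hPint n u hu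
end
end

section
/- (Equation for the derivative of the eigenfunction.) Let f : Ω → ℝ be Lipschitz and normalized (L_f(1) ≡ 1), let μ_f be a Borel probability on Ω with ∫ L_f(w) dμ_f = ∫ w dμ_f for every bounded continuous w, and let g : Ω → ℝ be Lipschitz. Suppose λ : ℝ → ℝ is differentiable at 0 with λ(0) = 1 and λ′(0) = ∫_Ω g dμ_f, and W : ℝ → C(Ω, ℝ) is differentiable at 0 in the supremum norm with W(0) ≡ 1, and that L_{f+tg}(W(t)) = λ(t)·W(t) for all t ∈ ℝ. Then the derivative v := W′(0) ∈ C(Ω, ℝ) satisfies, as an identity of functions on Ω, L_f(v) − v = ∫_Ω g dμ_f − L_f(g). -/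
open MeasureTheory Filter Topology

noncomputable section

theorem LipschitzSeq.cont {M : Type*} [MetricSpace M] [CompactSpace M]
    {f : (ℕ → M) → ℝ} (hf : LipschitzSeq f) : Continuous f := by
  obtain ⟨K, hK, h⟩ := hf
  obtain ⟨C, hC⟩ := Metric.isBounded_iff.1 (isCompact_univ (X := M)).isBounded
  rw [continuous_iff_continuousAt]
  intro x
  have hs : Continuous (fun y : ℕ → M => seqDist y x) := by
    unfold seqDist
    refine continuous_tsum (u := fun n : ℕ => (1 / 2 : ℝ) ^ n * C) (fun n => by fun_prop) ?_ ?_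
    · exact (summable_geometric_of_lt_one (by norm_num) (by norm_num)).mul_right C
    · intro n y
      rw [Real.norm_of_nonneg (by positivity)]
      exact mul_le_mul_of_nonneg_left (hC trivial trivial) (by positivity)
  have h0 : Tendsto (fun y : ℕ → M => K * seqDist y x) (𝓝 x) (𝓝 0) := by
    have := (hs.const_mul K).tendsto x
    simpa [seqDist] using this
  rw [ContinuousAt, tendsto_iff_dist_tendsto_zero]
  exact squeeze_zero (fun _ => dist_nonneg) (fun y => by rw [Real.dist_eq]; exact h y x) h0

theorem cons_cont {M : Type*} [TopologicalSpace M] (x : ℕ → M) :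
    Continuous (fun a : M => cons' a x) := by
  refine continuous_pi fun n => ?_
  cases n with
  | zero => exact continuous_id
  | succ n => exact continuous_const

theorem cm_integrable {M : Type*} [MetricSpace M] [CompactSpace M]
    [MeasurableSpace M] [BorelSpace M]
    (ν : Measure M) [IsProbabilityMeasure ν] (u : C(M, ℝ)) : Integrable (fun a => u a) ν :=
  u.continuous.integrable_of_hasCompactSupport (HasCompactSupport.of_compactSpace _)

def intCLM {M : Type*} [MetricSpace M] [CompactSpace M]
    [MeasurableSpace M] [BorelSpace M]
    (ν : Measure M) [IsProbabilityMeasure ν] : C(M, ℝ) →L[ℝ] ℝ :=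
  LinearMap.mkContinuous
    { toFun := fun u => ∫ a, u a ∂ν
      map_add' := fun u v => integral_add (cm_integrable ν u) (cm_integrable ν v)
      map_smul' := fun c u => integral_const_mul c _ } 1 (fun u => by
        have := norm_integral_le_of_norm_le_const (μ := ν) (f := fun a => u a) (C := ‖u‖)
          (Eventually.of_forall fun a => u.norm_coe_le_norm a)
        simpa using this)

def compCLM {X Y : Type*} [TopologicalSpace X] [TopologicalSpace Y] (p : C(X, Y)) :
    C(Y, ℝ) →L[ℝ] C(X, ℝ) where
  toFun u := u.comp p
  map_add' _ _ := rfl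
  map_smul' _ _ := rfl
  cont := ContinuousMap.continuous_precomp p

theorem cm_exp_apply {M : Type*} [TopologicalSpace M] [CompactSpace M] (u : C(M, ℝ)) (a : M) :
    NormedSpace.exp u a = Real.exp (u a) := by
  rw [Real.exp_eq_exp_ℝ]
  exact NormedSpace.map_exp (ContinuousMap.evalAlgHom ℝ ℝ a)
    (continuous_eval_const a) u

/-- the derivative `v = W′(0)` of the eigenfunction family
satisfies `(L_f − I)(v) = ∫ g dμ_f − L_f(g)`. -/
theorem stmt_15 {M : Type*} [MetricSpace M] [CompactSpace M]
    [MeasurableSpace M] [BorelSpace M]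
    (ν : Measure M) [IsProbabilityMeasure ν] [ν.IsOpenPosMeasure]
    (f : (ℕ → M) → ℝ) (hf : LipschitzSeq f)
    (hnorm : ∀ x, ruelle ν f (fun _ => (1 : ℝ)) x = 1)
    (μ : Measure (ℕ → M)) [IsProbabilityMeasure μ]
    (hfix : ∀ w : (ℕ → M) → ℝ, Continuous w →
      ∫ x, ruelle ν f w x ∂μ = ∫ x, w x ∂μ)
    (g : (ℕ → M) → ℝ) (hg : LipschitzSeq g)
    (lam : ℝ → ℝ) (hlam0 : lam 0 = 1)
    (hlam : HasDerivAt lam (∫ x, g x ∂μ) 0)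
    (W : ℝ → C(ℕ → M, ℝ)) (V : C(ℕ → M, ℝ))
    (hW : HasDerivAt W V 0) (hW0 : W 0 = 1)
    (heig : ∀ (t : ℝ) (x : ℕ → M),
      ruelle ν (fun y => f y + t * g y) (fun y => W t y) x = lam t * W t x) :
    ∀ x : ℕ → M,
      ruelle ν f (fun y => V y) x - V x = (∫ y, g y ∂μ) - ruelle ν f g x := by
  intro x
  let p : C(M, ℕ → M) := ⟨fun a => cons' a x, cons_cont x⟩
  let E : C(M, ℝ) := ⟨fun a => Real.exp (f (cons' a x)),
    Real.continuous_exp.comp (hf.cont.comp (cons_cont x))⟩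
  let G : C(M, ℝ) := ⟨fun a => g (cons' a x), hg.cont.comp (cons_cont x)⟩
  have h1 : HasDerivAt (fun t : ℝ => NormedSpace.exp (t • G)) G 0 := by
    simpa using hasDerivAt_exp_smul_const (𝕂 := ℝ) G (0 : ℝ)
  have h2 : HasDerivAt (fun t : ℝ => compCLM p (W t)) (compCLM p V) 0 :=
    (compCLM p).hasFDerivAt.comp_hasDerivAt 0 hW
  have h3 := (intCLM ν).hasFDerivAt.comp_hasDerivAt 0 ((h1.mul h2).const_mul E)
  have h4 : HasDerivAt (fun t => lam t * W t x) ((∫ y, g y ∂μ) * W 0 x + lam 0 * V x) 0 :=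
    hlam.mul ((ContinuousMap.evalCLM ℝ x : C(ℕ → M, ℝ) →L[ℝ] ℝ).hasFDerivAt.comp_hasDerivAt 0 hW)
  have h5 : (fun t => lam t * W t x) = (intCLM ν) ∘
      (fun t : ℝ => E * (NormedSpace.exp (t • G) * compCLM p (W t))) := by
    funext t
    rw [← heig t x]
    refine integral_congr_ae (Eventually.of_forall fun a => ?_)
    change _ = Real.exp (f (cons' a x)) * (NormedSpace.exp (t • G) a * W t (cons' a x))
    rw [cm_exp_apply, ← mul_assoc, ← Real.exp_add]
    rfl
  rw [h5] at h4
  have h6 := h4.unique h3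
  have h7 : intCLM ν (E * (G * compCLM p (W 0) + NormedSpace.exp ((0 : ℝ) • G) * compCLM p V))
      = ruelle ν f g x + ruelle ν f (fun y => V y) x := by
    have e : E * (G * compCLM p (W 0) + NormedSpace.exp ((0 : ℝ) • G) * compCLM p V)
        = E * G + E * compCLM p V := by
      have : compCLM p (W 0) = 1 := by rw [hW0]; rfl
      rw [this]; simp [mul_add]
    rw [e, map_add]
    rfl
  rw [h7, hW0, hlam0] at h6
  simp at h6
  linarith
end
end
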